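/- Let H = 1/6, let (Ω,F,P) be a probability space, and let X¹, X² : ℝ → Ω → ℝ be two independent centered Gaussian processes, each with covariance C_{1/6}. Let f₁, f₂, f₃, f₄ ∈ C_b^∞(ℝ²) and fix t ≥ 0. Then for each i ∈ {1,2} there exists a constant C > 0, depending only on f₁,…,f₄ (not on n or t), such that sup_{n≥1} sup_{i₁,i₂ ∈ {0,…,⌊2^{n/2}t⌋−1}} Σ_{i₃,i₄=0}^{⌊2^{n/2}t⌋−1} | E[ Π_{a=1}^{4} Δ_{i_a,n}f_a(X¹,X²) · ((Δⁱ_{i₃,n})³ − 3·2^{−n/3}·Δⁱ_{i₃,n}) · ((Δⁱ_{i₄,n})³ − 3·2^{−n/3}·Δⁱ_{i₄,n}) ] | ≤ C(t + t²). -/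

import Mathlib

open MeasureTheory ProbabilityTheory Filter

noncomputable section

/-- Covariance function of the (two-sided) fractional Brownian motion with Hurst index `H`:
`C_H(t,s) = (|t|^{2H} + |s|^{2H} − |t−s|^{2H})/2`. -/
def covH (H t s : ℝ) : ℝ :=
  (|t| ^ (2 * H) + |s| ^ (2 * H) - |t - s| ^ (2 * H)) / 2

/-- `ρ_H(k) = (1/2)(|k+1|^{2H} + |k−1|^{2H} − 2|k|^{2H})`. -/
def rhoH (H : ℝ) (k : ℤ) : ℝ :=
  (|(k : ℝ) + 1| ^ (2 * H) + |(k : ℝ) - 1| ^ (2 * H) - 2 * |(k : ℝ)| ^ (2 * H)) / 2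

/-- `X` is a centered Gaussian process with covariance function `C` under `P`: every finite
linear combination of values of the process is a centered real Gaussian random variable with
the appropriate variance. -/
def IsCenteredGaussianProcess {Ω : Type*} [MeasurableSpace Ω] (P : Measure Ω)
    (X : ℝ → Ω → ℝ) (C : ℝ → ℝ → ℝ) : Prop :=
  (∀ t, Measurable (X t)) ∧
  ∀ (m : ℕ) (ts : Fin m → ℝ) (c : Fin m → ℝ),
    Measure.map (fun ω => ∑ i, c i * X (ts i) ω) P =
      gaussianReal 0 (Real.toNNReal (∑ i, ∑ j, c i * c j * C (ts i) (ts j)))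

/-- The σ-algebras generated by the two processes `X1` and `X2` are independent under `P`. -/
def IndepProcesses {Ω : Type*} [MeasurableSpace Ω] (P : Measure Ω)
    (X1 X2 : ℝ → Ω → ℝ) : Prop :=
  ProbabilityTheory.Indep
    (⨆ t : ℝ, MeasurableSpace.comap (X1 t) inferInstance)
    (⨆ t : ℝ, MeasurableSpace.comap (X2 t) inferInstance) P

/-- `g` is infinitely differentiable and bounded together with all its derivatives. -/
def CbSmooth {E : Type*} [NormedAddCommGroup E] [NormedSpace ℝ E] (g : E → ℝ) : Prop :=
  (∀ n : ℕ, ContDiff ℝ n g) ∧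
  ∀ k : ℕ, ∃ M : ℝ, ∀ x : E, ‖iteratedFDeriv ℝ k g x‖ ≤ M

/-- `f : ℝ² → ℝ` (in curried form) belongs to `C_b^∞(ℝ²)`. -/
def CbSmooth2 (f : ℝ → ℝ → ℝ) : Prop :=
  CbSmooth fun p : ℝ × ℝ => f p.1 p.2

/-- Partial derivative of `f : ℝ → ℝ → ℝ`, taken `k` times in the first variable and `l` times
in the second variable. -/
def pd (k l : ℕ) (f : ℝ → ℝ → ℝ) (x y : ℝ) : ℝ :=
  iteratedDeriv k (fun u => iteratedDeriv l (fun v => f u v) y) x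

/-- The dyadic point `j·2^{−n/2}`. -/
def dyadicPt (n j : ℕ) : ℝ := (j : ℝ) * (2 : ℝ) ^ (-(n : ℝ) / 2)

/-- The number of dyadic steps `⌊2^{n/2} t⌋`. -/
def nSteps (n : ℕ) (t : ℝ) : ℕ := Nat.floor ((2 : ℝ) ^ ((n : ℝ) / 2) * t)

variable {Ω : Type*}

/-- The increment `X_{(j+1)2^{−n/2}} − X_{j2^{−n/2}}` of the process `X`. -/
def Xincr (X : ℝ → Ω → ℝ) (n j : ℕ) (ω : Ω) : ℝ :=
  X (dyadicPt n (j + 1)) ω - X (dyadicPt n j) ω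

/-- The midpoint evaluation `Δ_{j,n} g(X¹,X²)`. -/
def Xmid (X1 X2 : ℝ → Ω → ℝ) (g : ℝ → ℝ → ℝ) (n j : ℕ) (ω : Ω) : ℝ :=
  g ((X1 (dyadicPt n (j + 1)) ω + X1 (dyadicPt n j) ω) / 2)
    ((X2 (dyadicPt n (j + 1)) ω + X2 (dyadicPt n j) ω) / 2)

lemma integral_id_mul_gaussianReal_eq {v : NNReal} (hv : v ≠ 0) {g g' : ℝ → ℝ}
    (hd : ∀ x, HasDerivAt g (g' x) x) (hg : Integrable g (gaussianReal 0 v))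
    (hxg : Integrable (fun x => x * g x) (gaussianReal 0 v))
    (hg' : Integrable g' (gaussianReal 0 v)) :
    ∫ x, x * g x ∂(gaussianReal 0 v) = v * ∫ x, g' x ∂(gaussianReal 0 v) := by
  have key : ∀ f : ℝ → ℝ, Integrable f (gaussianReal 0 v) →
      Integrable (fun x => gaussianPDFReal 0 v x * f x) := by
    intro f hf
    rw [gaussianReal_of_var_ne_zero _ hv,
      integrable_withDensity_iff_integrable_smul' (measurable_gaussianPDF 0 v)
        (ae_of_all _ fun x => gaussianPDF_lt_top)] at hf
    simpa using hf
  have hv' : (v : ℝ) ≠ 0 := by exact_mod_cast hv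
  have hpdf : ∀ x, HasDerivAt (gaussianPDFReal 0 v) (-(x / v) * gaussianPDFReal 0 v x) x := by
    intro x
    rw [gaussianPDFReal_def]
    have h1 : HasDerivAt (fun x : ℝ => -(x - 0) ^ 2 / (2 * (v : ℝ))) (-(x / v)) x := by
      have := ((((hasDerivAt_id x).sub_const 0).pow 2).neg).div_const (2 * (v : ℝ))
      refine this.congr_deriv ?_
      simp
      field_simp
    refine (h1.exp.const_mul _).congr_deriv ?_
    ring
  have h0 := integral_eq_zero_of_hasDerivAt_of_integrable
    (f := fun x => gaussianPDFReal 0 v x * g x)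
    (f' := fun x => gaussianPDFReal 0 v x * g' x - (v : ℝ)⁻¹ * (gaussianPDFReal 0 v x * (x * g x)))
    (fun x => ((hpdf x).mul (hd x)).congr_deriv (by ring))
    ((key _ hg').sub ((key _ hxg).const_mul _)) (key _ hg)
  rw [integral_sub (key _ hg') ((key _ hxg).const_mul _), integral_const_mul] at h0
  rw [integral_gaussianReal_eq_integral_smul hv, integral_gaussianReal_eq_integral_smul hv]
  simp only [smul_eq_mul]
  field_simp at h0 ⊢
  linarith

/-- Gaussian integration by parts for a centered Gaussian vector `V`. -/
lemma integral_mul_eq_integral_fderiv {Ω : Type*} [MeasurableSpace Ω] {P : Measure Ω}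
    {κ : Type*} [Fintype κ] {V : Ω → κ → ℝ} (hV : HasGaussianLaw V P)
    (L : (κ → ℝ) →L[ℝ] ℝ) (c : κ → ℝ) {v : NNReal} (hv : v ≠ 0)
    (hL : P.map (fun ω => L (V ω)) = gaussianReal 0 v)
    (hc : ∀ k, cov[fun ω => L (V ω), fun ω => V ω k; P] = c k)
    {g : (κ → ℝ) → ℝ} (hg : ContDiff ℝ 1 g)
    (hi : Integrable (fun ω => g (V ω)) P) (hi1 : Integrable (fun ω => L (V ω) * g (V ω)) P)
    (hi2 : Integrable (fun ω => fderiv ℝ g (V ω) c) P) :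
    ∫ ω, L (V ω) * g (V ω) ∂P = ∫ ω, fderiv ℝ g (V ω) c ∂P := by
  have : IsProbabilityMeasure P := hV.isProbabilityMeasure
  have hv' : (v : ℝ) ≠ 0 := by exact_mod_cast hv
  set U : Ω → κ → ℝ := fun ω => V ω - (L (V ω) / v) • c with hU
  have hVm : AEMeasurable V P := hV.aemeasurable
  have hLm : AEMeasurable (fun ω => L (V ω)) P := by fun_prop
  have hUm : AEMeasurable U P := by fun_prop
  have hlin : HasGaussianLaw (fun ω => ((fun _ : Unit => L (V ω)), fun k => U ω k)) P := by
    have := hV.map (((ContinuousLinearMap.pi fun _ : Unit => L)).prod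
      (ContinuousLinearMap.id ℝ (κ → ℝ) - (L.smulRight ((v : ℝ)⁻¹ • c))))
    have e : (fun ω => ((fun _ : Unit => L (V ω)), fun k => U ω k)) =
        ⇑((ContinuousLinearMap.pi fun _ : Unit => L).prod
          (ContinuousLinearMap.id ℝ (κ → ℝ) - L.smulRight ((v : ℝ)⁻¹ • c))) ∘ V := by
      funext ω
      refine Prod.ext ?_ ?_
      · rfl
      · funext k
        simp [hU, div_eq_mul_inv, mul_assoc]
    rw [e]
    exact this
  have hmem : ∀ k, MemLp (fun ω => V ω k) 2 P := fun k =>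
    (hV.map (ContinuousLinearMap.proj k)).memLp_two
  have hmemL : MemLp (fun ω => L (V ω)) 2 P := (hV.map L).memLp_two
  have hvar : cov[fun ω => L (V ω), fun ω => L (V ω); P] = v := by
    rw [covariance_self hLm, ← variance_fun_id_gaussianReal (μ := 0) (v := v), ← hL,
      variance_map (by fun_prop) hLm]
    rfl
  have hind : IndepFun (fun ω => L (V ω)) U P := by
    have h := hlin.indepFun_of_covariance_eval (X := fun _ : Unit => fun ω => L (V ω))
      (Y := fun k => fun ω => U ω k) (fun _ k => by
        have : (fun ω => U ω k) = fun ω => V ω k - (c k / v) * L (V ω) := by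
          ext ω; simp [hU]; ring
        rw [this, covariance_fun_sub_right hmemL (hmem k) (hmemL.const_mul _),
          covariance_const_mul_right, hc, hvar]
        field_simp
        simp)
    exact h.comp (measurable_pi_apply ()) measurable_id
  have hprod := (indepFun_iff_map_prod_eq_prod_map_map hLm hUm).1 hind
  rw [hL] at hprod
  have hVU : ∀ ω, V ω = U ω + (L (V ω) / v) • c := fun ω => by simp [hU]
  have : IsProbabilityMeasure (P.map U) := Measure.isProbabilityMeasure_map hUm
  have hpm : AEMeasurable (fun ω => (L (V ω), U ω)) P := hLm.prodMk hUm
  have hfd : Continuous fun x => fderiv ℝ g x c :=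
    (hg.continuous_fderiv (by norm_num)).clm_apply continuous_const
  have hgc := hg.continuous
  -- transfer to the product space
  have tr : ∀ G : ℝ × (κ → ℝ) → ℝ, Continuous G → Integrable (fun ω => G (L (V ω), U ω)) P →
      Integrable G ((gaussianReal 0 v).prod (P.map U)) ∧
        ∫ ω, G (L (V ω), U ω) ∂P = ∫ u, ∫ a, G (a, u) ∂(gaussianReal 0 v) ∂(P.map U) := by
    intro G hG hI
    have h1 : Integrable G ((gaussianReal 0 v).prod (P.map U)) := by
      rw [← hprod, integrable_map_measure (by fun_prop) hpm]
      exact hI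
    refine ⟨h1, ?_⟩
    rw [← integral_prod_symm _ h1, ← hprod, integral_map hpm (by fun_prop)]
  obtain ⟨i0, -⟩ := tr (fun p => g (p.2 + (p.1 / v) • c)) (by fun_prop)
    (by simpa only [← hVU] using hi)
  obtain ⟨i1, e1⟩ := tr (fun p => p.1 * g (p.2 + (p.1 / v) • c)) (by fun_prop)
    (by simpa only [← hVU] using hi1)
  obtain ⟨i2, e2⟩ := tr (fun p => fderiv ℝ g (p.2 + (p.1 / v) • c) c) (hfd.comp (by fun_prop))
    (by simpa only [← hVU] using hi2)
  simp only [← hVU] at e1 e2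
  rw [e1, e2]
  refine integral_congr_ae ?_
  filter_upwards [i0.prod_left_ae, i1.prod_left_ae, i2.prod_left_ae] with u h0 h1 h2
  rw [integral_id_mul_gaussianReal_eq hv (g' := fun a => fderiv ℝ g (u + (a / v) • c) c * (v : ℝ)⁻¹)
    ?_ h0 h1 (h2.mul_const _), integral_mul_const]
  · field_simp
  · intro a
    have hline : HasDerivAt (fun a : ℝ => u + (a / (v : ℝ)) • c) ((v : ℝ)⁻¹ • c) a := by
      have := (((hasDerivAt_id a).div_const (v : ℝ)).smul_const c).const_add u
      simpa using this
    have := ((hg.differentiable (by norm_num) (u + (a / (v : ℝ)) • c)).hasFDerivAt).comp_hasDerivAt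
      a hline
    refine this.congr_deriv ?_
    simp [mul_comm]

section Moments

variable {E F : Type*} [NormedAddCommGroup E] [NormedSpace ℝ E]
  [NormedAddCommGroup F] [NormedSpace ℝ F]

/-- The derivative of `Φ` in the constant direction `c`. -/
def dirDeriv (c : F) (Φ : F → ℝ) (x : F) : ℝ := fderiv ℝ Φ x c

/-- `Φ` is smooth and its derivatives up to order `K` are bounded by `M`. -/
def DerivBound (K : ℕ) (M : ℝ) (Φ : F → ℝ) : Prop :=
  (∀ n : ℕ, ContDiff ℝ n Φ) ∧ ∀ k ≤ K, ∀ x : F, ‖iteratedFDeriv ℝ k Φ x‖ ≤ M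

lemma contDiff_dirDeriv {Φ : F → ℝ} (h : ∀ n : ℕ, ContDiff ℝ n Φ) (c : F) (n : ℕ) :
    ContDiff ℝ n (dirDeriv c Φ) := by
  have h1 : ContDiff ℝ ((n : WithTop ℕ∞) + 1) Φ := by exact_mod_cast h (n + 1)
  exact (h1.fderiv_right le_rfl).clm_apply contDiff_const

lemma norm_iteratedFDeriv_dirDeriv_le {Φ : F → ℝ} (h : ∀ n : ℕ, ContDiff ℝ n Φ) (c : F) (k : ℕ)
    (x : F) : ‖iteratedFDeriv ℝ k (dirDeriv c Φ) x‖ ≤ ‖c‖ * ‖iteratedFDeriv ℝ (k + 1) Φ x‖ := by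
  have h1 : ContDiff ℝ ((k : WithTop ℕ∞) + 1) Φ := by exact_mod_cast h (k + 1)
  rw [← norm_iteratedFDeriv_fderiv]
  exact norm_iteratedFDeriv_clm_apply_const (h1.fderiv_right le_rfl).contDiffAt le_rfl

lemma CbSmooth.dirDeriv {Φ : F → ℝ} (h : CbSmooth Φ) (c : F) : CbSmooth (dirDeriv c Φ) := by
  refine ⟨contDiff_dirDeriv h.1 c, fun k => ?_⟩
  obtain ⟨M, hM⟩ := h.2 (k + 1)
  exact ⟨‖c‖ * M, fun x => (norm_iteratedFDeriv_dirDeriv_le h.1 c k x).trans (by gcongr; exact hM x)⟩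

lemma DerivBound.dirDeriv {K : ℕ} {M : ℝ} {Φ : F → ℝ} (h : DerivBound (K + 1) M Φ) (c : F) :
    DerivBound K (‖c‖ * M) (dirDeriv c Φ) :=
  ⟨contDiff_dirDeriv h.1 c, fun k hk x =>
    (norm_iteratedFDeriv_dirDeriv_le h.1 c k x).trans (by gcongr; exact h.2 _ (by omega) x)⟩

lemma DerivBound.abs_le {K : ℕ} {M : ℝ} {Φ : F → ℝ} (h : DerivBound K M Φ) (x : F) :
    |Φ x| ≤ M := by
  simpa using h.2 0 (Nat.zero_le _) x

lemma CbSmooth.exists_derivBound {Φ : F → ℝ} (h : CbSmooth Φ) (K : ℕ) :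
    ∃ M, 0 ≤ M ∧ DerivBound K M Φ := by
  choose M hM using h.2
  have hM0 : ∀ k, 0 ≤ M k := fun k => (norm_nonneg _).trans (hM k 0)
  refine ⟨∑ k ∈ Finset.range (K + 1), M k, Finset.sum_nonneg fun k _ => hM0 k, h.1,
    fun k hk x => (hM k x).trans ?_⟩
  exact Finset.single_le_sum (fun k _ => hM0 k) (Finset.mem_range.2 (by omega))

lemma CbSmooth.exists_abs_le {Φ : F → ℝ} (h : CbSmooth Φ) : ∃ M, ∀ x, |Φ x| ≤ M :=
  let ⟨M, _, hM⟩ := h.exists_derivBound 0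
  ⟨M, hM.abs_le⟩

lemma CbSmooth.mul {Φ Ψ : F → ℝ} (h : CbSmooth Φ) (h' : CbSmooth Ψ) :
    CbSmooth fun x => Φ x * Ψ x := by
  refine ⟨fun n => (h.1 n).mul (h'.1 n), fun k => ?_⟩
  obtain ⟨M, hM0, hM⟩ := h.exists_derivBound k
  obtain ⟨M', hM0', hM'⟩ := h'.exists_derivBound k
  refine ⟨∑ i ∈ Finset.range (k + 1), (k.choose i : ℝ) * M * M', fun x => ?_⟩
  refine (norm_iteratedFDeriv_mul_le (h.1 k) (h'.1 k) x le_rfl).trans ?_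
  gcongr with i hi
  · exact hM.2 i (by simp at hi; omega) x
  · exact hM'.2 _ (by omega) x

lemma CbSmooth.comp_clm {Φ : F → ℝ} (h : CbSmooth Φ) (T : E →L[ℝ] F) :
    CbSmooth fun x => Φ (T x) := by
  refine ⟨fun n => (h.1 n).comp T.contDiff, fun k => ?_⟩
  obtain ⟨M, hM⟩ := h.2 k
  refine ⟨M * ∏ _i : Fin k, ‖T‖, fun x => ?_⟩
  have := T.iteratedFDeriv_comp_right (h.1 k) x (i := k) le_rfl
  change ‖iteratedFDeriv ℝ k (Φ ∘ T) x‖ ≤ _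
  rw [this]
  refine (ContinuousMultilinearMap.norm_compContinuousLinearMap_le _ _).trans ?_
  gcongr
  exact hM _

end Moments

lemma third_moment_expansion {F : Type*} {S : (F → ℝ) → Prop} {DA DB : (F → ℝ) → F → ℝ}
    (hSA : ∀ Φ, S Φ → S (DA Φ)) (hSB : ∀ Φ, S Φ → S (DB Φ)) {m : (F → ℝ) → ℕ → ℕ → ℝ} {v r : ℝ}
    (hA : ∀ Φ, S Φ → ∀ i j : ℕ, m Φ (i + 1) j =
      m (DA Φ) i j + i * v * m Φ (i - 1) j + j * r * m Φ i (j - 1))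
    (hB : ∀ Φ, S Φ → ∀ j : ℕ, m Φ 0 (j + 1) = m (DB Φ) 0 j + j * v * m Φ 0 (j - 1))
    {Φ : F → ℝ} (hΦ : S Φ) (l : ℝ) :
    m Φ 3 3 - l * m Φ 3 1 - l * m Φ 1 3 + l ^ 2 * m Φ 1 1 =
      m (DB (DB (DB (DA (DA (DA Φ)))))) 0 0 + 9 * r * m (DB (DB (DA (DA Φ)))) 0 0
      + 18 * r ^ 2 * m (DB (DA Φ)) 0 0 + 6 * r ^ 3 * m Φ 0 0
      + (3 * v - l) * (m (DB (DA (DA (DA Φ)))) 0 0 + 3 * r * m (DA (DA Φ)) 0 0)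
      + (3 * v - l) * (m (DB (DB (DB (DA Φ)))) 0 0 + 3 * r * m (DB (DB Φ)) 0 0)
      + (3 * v - l) ^ 2 * (m (DB (DA Φ)) 0 0 + r * m Φ 0 0) := by
  have hA1 : ∀ Φ, S Φ → ∀ j : ℕ, m Φ 1 j = m (DA Φ) 0 j + j * r * m Φ 0 (j - 1) :=
    fun Φ h j => by simpa using hA Φ h 0 j
  have hA2 : ∀ Φ, S Φ → ∀ j : ℕ,
      m Φ 2 j = m (DA Φ) 1 j + v * m Φ 0 j + j * r * m Φ 1 (j - 1) :=
    fun Φ h j => by simpa using hA Φ h 1 j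
  have hA3 : ∀ Φ, S Φ → ∀ j : ℕ,
      m Φ 3 j = m (DA Φ) 2 j + 2 * v * m Φ 1 j + j * r * m Φ 2 (j - 1) :=
    fun Φ h j => by simpa using hA Φ h 2 j
  have hB1 : ∀ Φ, S Φ → m Φ 0 1 = m (DB Φ) 0 0 := fun Φ h => by simpa using hB Φ h 0
  have hB2 : ∀ Φ, S Φ → m Φ 0 2 = m (DB Φ) 0 1 + v * m Φ 0 0 := fun Φ h => by simpa using hB Φ h 1
  have hB3 : ∀ Φ, S Φ → m Φ 0 3 = m (DB Φ) 0 2 + 2 * v * m Φ 0 1 :=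
    fun Φ h => by simpa using hB Φ h 2
  have s1 := hSA _ hΦ
  have s2 := hSA _ s1
  have s3 := hSA _ s2
  have hSB2 : ∀ Φ, S Φ → S (DB (DB Φ)) := fun Φ h => hSB _ (hSB _ h)
  simp only [hA3, hA2, hA1, hB3, hB2, hB1, hΦ, s1, s2, s3, hSB, hSB2, Nat.cast_ofNat, Nat.cast_one,
    Nat.reduceSub, Nat.sub_self, Nat.cast_zero]
  ring

lemma abs_expansion_le {M v r k a b x0 x1 x2 x3 x4 x5 x6 x7 : ℝ} (hM : 0 ≤ M) (hv0 : 0 ≤ v)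
    (hv1 : v ≤ 1) (hr : |r| ≤ v) (hk : |k| ≤ 3 * v) (ha0 : 0 ≤ a) (ha : a ≤ v) (hb0 : 0 ≤ b)
    (hb : b ≤ v) (h0 : |x0| ≤ M) (h1 : |x1| ≤ b * (b * (b * (a * (a * (a * M))))))
    (h2 : |x2| ≤ b * (b * (a * (a * M)))) (h3 : |x3| ≤ b * (a * M))
    (h4 : |x4| ≤ b * (a * (a * (a * M)))) (h5 : |x5| ≤ a * (a * M))
    (h6 : |x6| ≤ b * (b * (b * (a * M)))) (h7 : |x7| ≤ b * (b * M)) :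
    |x1 + 9 * r * x2 + 18 * r ^ 2 * x3 + 6 * r ^ 3 * x0 + k * (x4 + 3 * r * x5)
      + k * (x6 + 3 * r * x7) + k ^ 2 * (x3 + r * x0)| ≤
      100 * M * (v ^ 2 * |r| + v ^ 3 * b) := by
  have hs0 := abs_nonneg r
  set s := |r| with hs
  have hrs : |r| = s := rfl
  have hb1 : b ≤ 1 := hb.trans hv1
  have ha1 : a ≤ 1 := ha.trans hv1
  have hs1 : s ≤ 1 := hr.trans hv1
  have e1 : |x1| ≤ M * (v ^ 3 * b) := h1.trans <| by
    calc b * (b * (b * (a * (a * (a * M))))) = M * ((a * a * a) * b) * (b * b) := by ring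
      _ ≤ M * ((v * v * v) * b) * (1 * 1) := by gcongr
      _ = _ := by ring
  have e2 : |9 * r * x2| ≤ 9 * (M * (v ^ 2 * s)) := by
    calc |9 * r * x2| = 9 * s * |x2| := by rw [abs_mul, abs_mul, hrs]; norm_num
      _ ≤ 9 * s * (b * (b * (a * (a * M)))) := by gcongr
      _ = 9 * M * s * (b * b) * (a * a) := by ring
      _ ≤ 9 * M * s * (1 * 1) * (v * v) := by gcongr
      _ = _ := by ring
  have e3 : |18 * r ^ 2 * x3| ≤ 18 * (M * (v ^ 2 * s)) := by
    calc |18 * r ^ 2 * x3| = 18 * s ^ 2 * |x3| := by rw [abs_mul, abs_mul, abs_pow, hrs]; norm_num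
      _ ≤ 18 * s ^ 2 * (b * (a * M)) := by gcongr
      _ = 18 * M * s * s * (b * a) := by ring
      _ ≤ 18 * M * s * 1 * (v * v) := by gcongr
      _ = _ := by ring
  have e4 : |6 * r ^ 3 * x0| ≤ 6 * (M * (v ^ 2 * s)) := by
    calc |6 * r ^ 3 * x0| = 6 * s ^ 3 * |x0| := by rw [abs_mul, abs_mul, abs_pow, hrs]; norm_num
      _ ≤ 6 * s ^ 3 * M := by gcongr
      _ = 6 * M * s * (s * s) := by ring
      _ ≤ 6 * M * s * (v * v) := by gcongr
      _ = _ := by ring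
  have e5 : |k * (x4 + 3 * r * x5)| ≤ 3 * (M * (v ^ 3 * b)) + 9 * (M * (v ^ 2 * s)) := by
    have : |x4 + 3 * r * x5| ≤ |x4| + 3 * s * |x5| := by
      refine (abs_add_le _ _).trans_eq ?_
      rw [abs_mul, abs_mul, hrs]; norm_num
    calc |k * (x4 + 3 * r * x5)| ≤ 3 * v * (|x4| + 3 * s * |x5|) := by rw [abs_mul]; gcongr
      _ ≤ 3 * v * (b * (a * (a * (a * M))) + 3 * s * (a * (a * M))) := by gcongr
      _ = 3 * M * v * b * a * (a * a) + 9 * M * s * v * a * a := by ring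
      _ ≤ 3 * M * v * b * 1 * (v * v) + 9 * M * s * v * v * 1 := by gcongr
      _ = _ := by ring
  have e6 : |k * (x6 + 3 * r * x7)| ≤ 3 * (M * (v ^ 3 * b)) + 9 * (M * (v ^ 2 * s)) := by
    have : |x6 + 3 * r * x7| ≤ |x6| + 3 * s * |x7| := by
      refine (abs_add_le _ _).trans_eq ?_
      rw [abs_mul, abs_mul, hrs]; norm_num
    calc |k * (x6 + 3 * r * x7)| ≤ 3 * v * (|x6| + 3 * s * |x7|) := by rw [abs_mul]; gcongr
      _ ≤ 3 * v * (b * (b * (b * (a * M))) + 3 * s * (b * (b * M))) := by gcongr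
      _ = 3 * M * v * b * a * (b * b) + 9 * M * s * v * b * b := by ring
      _ ≤ 3 * M * v * b * 1 * (v * v) + 9 * M * s * v * v * 1 := by gcongr
      _ = _ := by ring
  have e7 : |k ^ 2 * (x3 + r * x0)| ≤ 9 * (M * (v ^ 3 * b)) + 9 * (M * (v ^ 2 * s)) := by
    have : |x3 + r * x0| ≤ |x3| + s * |x0| := by
      refine (abs_add_le _ _).trans_eq ?_
      rw [abs_mul, hrs]
    calc |k ^ 2 * (x3 + r * x0)| ≤ (3 * v) ^ 2 * (|x3| + s * |x0|) := by
          rw [abs_mul, abs_pow]; gcongr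
      _ ≤ (3 * v) ^ 2 * (b * (a * M) + s * M) := by gcongr
      _ ≤ (3 * v) ^ 2 * (b * (v * M) + s * M) := by gcongr
      _ = _ := by ring
  have p1 : 0 ≤ M * (v ^ 3 * b) := by positivity
  have p2 : 0 ≤ M * (v ^ 2 * s) := by positivity
  have t : ∀ y1 y2 y3 y4 y5 y6 y7 : ℝ, |y1 + y2 + y3 + y4 + y5 + y6 + y7| ≤
      |y1| + |y2| + |y3| + |y4| + |y5| + |y6| + |y7| := fun y1 y2 y3 y4 y5 y6 y7 => by
    have := abs_add_le (y1 + y2 + y3 + y4 + y5 + y6) y7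
    have := abs_add_le (y1 + y2 + y3 + y4 + y5) y6
    have := abs_add_le (y1 + y2 + y3 + y4) y5
    have := abs_add_le (y1 + y2 + y3) y4
    have := abs_add_le (y1 + y2) y3
    have := abs_add_le y1 y2
    linarith
  refine (t _ _ _ _ _ _ _).trans ?_
  linarith

lemma integral_lin_comb {Ω : Type*} [MeasurableSpace Ω] {P : Measure Ω} {f g h : Ω → ℝ}
    (hf : Integrable f P) (hg : Integrable g P) (hh : Integrable h P) (a b : ℝ) :
    ∫ ω, (f ω + a * g ω + b * h ω) ∂P = ∫ ω, f ω ∂P + a * ∫ ω, g ω ∂P + b * ∫ ω, h ω ∂P := by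
  have h1 : Integrable (fun ω => f ω + a * g ω) P := hf.add (hg.const_mul a)
  rw [integral_add h1 (hh.const_mul b), integral_add hf (hg.const_mul a), integral_const_mul,
    integral_const_mul]

section MomentRecursion

variable {Ω : Type*} [MeasurableSpace Ω] {P : Measure Ω} {κ : Type*}
  {V : Ω → κ → ℝ} {F : Type*} [NormedAddCommGroup F] [NormedSpace ℝ F]

/-- The mixed moment `E[Φ(π V) (A V)^i (B V)^j]`. -/
def mixedMoment (P : Measure Ω) (V : Ω → κ → ℝ) (A B : (κ → ℝ) →L[ℝ] ℝ) (π : (κ → ℝ) →L[ℝ] F)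
    (Φ : F → ℝ) (i j : ℕ) : ℝ :=
  ∫ ω, Φ (π (V ω)) * A (V ω) ^ i * B (V ω) ^ j ∂P

lemma mixedMoment_swap (A B : (κ → ℝ) →L[ℝ] ℝ) (π : (κ → ℝ) →L[ℝ] F) (Φ : F → ℝ) (i j : ℕ) :
    mixedMoment P V A B π Φ i j = mixedMoment P V B A π Φ j i := by
  unfold mixedMoment
  simp only [mul_right_comm]

lemma integrable_mul_pow_mul_pow [Fintype κ] (hV : HasGaussianLaw V P) (A B : (κ → ℝ) →L[ℝ] ℝ)
    (π : (κ → ℝ) →L[ℝ] F) {Φ : F → ℝ} (hΦ : CbSmooth Φ) (i j : ℕ) :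
    Integrable (fun ω => Φ (π (V ω)) * A (V ω) ^ i * B (V ω) ^ j) P := by
  have : IsProbabilityMeasure P := hV.isProbabilityMeasure
  have hVm : AEMeasurable V P := hV.aemeasurable
  have hpow : ∀ (L : (κ → ℝ) →L[ℝ] ℝ) (k : ℕ), Integrable (fun ω => L (V ω) ^ (2 * k)) P := by
    intro L k
    have h := ((hV.map L).memLp (p := (2 * k : ℕ)) (ENNReal.natCast_ne_top _)).integrable_norm_pow'
    refine h.congr (ae_of_all _ fun ω => ?_)
    simp [pow_mul]
  have hΦc : Continuous Φ := (hΦ.1 0).continuous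
  obtain ⟨M, hM⟩ := hΦ.exists_abs_le
  have hc : Continuous fun x : κ → ℝ => Φ (π x) * A x ^ i * B x ^ j := by fun_prop
  refine (((hpow A i).add (hpow B j)).const_mul M).mono'
    (hc.measurable.comp_aemeasurable hVm).aestronglyMeasurable (ae_of_all _ fun ω => ?_)
  have hM0 : 0 ≤ M := (abs_nonneg _).trans (hM 0)
  simp only [Real.norm_eq_abs, Pi.add_apply, mul_assoc, abs_mul]
  refine mul_le_mul (hM _) ?_ (by positivity) hM0
  rw [two_mul, two_mul, pow_add, pow_add, ← abs_mul, abs_le]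
  constructor <;> nlinarith [sq_nonneg (A (V ω) ^ i + B (V ω) ^ j),
    sq_nonneg (A (V ω) ^ i - B (V ω) ^ j), sq_nonneg (A (V ω) ^ i), sq_nonneg (B (V ω) ^ j)]

lemma mixedMoment_succ [Fintype κ] (hV : HasGaussianLaw V P) {A B : (κ → ℝ) →L[ℝ] ℝ}
    (π : (κ → ℝ) →L[ℝ] F) {v : NNReal} (hv : v ≠ 0) {r : ℝ} {c : κ → ℝ}
    (hA : P.map (fun ω => A (V ω)) = gaussianReal 0 v)
    (hc : ∀ k, cov[fun ω => A (V ω), fun ω => V ω k; P] = c k)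
    (hAc : A c = v) (hBc : B c = r) {Φ : F → ℝ} (hΦ : CbSmooth Φ) (i j : ℕ) :
    mixedMoment P V A B π Φ (i + 1) j =
      mixedMoment P V A B π (dirDeriv (π c) Φ) i j +
        i * v * mixedMoment P V A B π Φ (i - 1) j + j * r * mixedMoment P V A B π Φ i (j - 1) := by
  have hΦ1 : ContDiff ℝ 1 Φ := by exact_mod_cast hΦ.1 1
  have hint := fun {Ψ : F → ℝ} (hΨ : CbSmooth Ψ) => integrable_mul_pow_mul_pow hV A B π hΨ
  have hfd : ∀ x, fderiv ℝ (fun x => Φ (π x) * A x ^ i * B x ^ j) x c =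
      dirDeriv (π c) Φ (π x) * A x ^ i * B x ^ j + i * v * (Φ (π x) * A x ^ (i - 1) * B x ^ j) +
        j * r * (Φ (π x) * A x ^ i * B x ^ (j - 1)) := by
    intro x
    have h1 : HasFDerivAt (fun x => Φ (π x)) ((fderiv ℝ Φ (π x)).comp π) x :=
      ((hΦ1.differentiable (by norm_num) _).hasFDerivAt).comp x π.hasFDerivAt
    have h := (h1.mul (A.hasFDerivAt.pow i)).mul ((B.hasFDerivAt (x := x)).pow j)
    have h' := congrArg (fun T => T c) h.fderiv
    refine Eq.trans h' ?_
    simp [dirDeriv, hAc, hBc]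
    ring
  have key := integral_mul_eq_integral_fderiv hV A c hv hA hc
    (g := fun x => Φ (π x) * A x ^ i * B x ^ j) (by fun_prop) (hint hΦ i j)
    ((hint hΦ (i + 1) j).congr (ae_of_all _ fun ω => by simp only; ring))
    (by
      simp only [hfd]
      exact ((hint (hΦ.dirDeriv _) i j).add ((hint hΦ _ _).const_mul _)).add
        ((hint hΦ _ _).const_mul _))
  simp only [hfd] at key
  rw [integral_lin_comb (hint (hΦ.dirDeriv _) i j) (hint hΦ _ _) (hint hΦ _ _)] at key
  refine Eq.trans ?_ key
  unfold mixedMoment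
  congr 1
  ext ω
  ring

lemma abs_mixedMoment_zero_le [IsProbabilityMeasure P] (A B : (κ → ℝ) →L[ℝ] ℝ)
    (π : (κ → ℝ) →L[ℝ] F) {Φ : F → ℝ} {K : ℕ} {M : ℝ} (hΦ : DerivBound K M Φ) :
    |mixedMoment P V A B π Φ 0 0| ≤ M := by
  have := norm_integral_le_of_norm_le_const (μ := P) (C := M)
    (f := fun ω => Φ (π (V ω)) * A (V ω) ^ 0 * B (V ω) ^ 0)
    (ae_of_all _ fun ω => by simpa using hΦ.abs_le _)
  simpa [mixedMoment] using this

/-- The expectation of a smooth bounded functional of a Gaussian vector against two third-order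
polynomials of Gaussian increments is controlled by the covariances. -/
lemma abs_integral_mul_cubic_mul_cubic_le [Fintype κ] (hV : HasGaussianLaw V P) {A B : (κ → ℝ) →L[ℝ] ℝ}
    (π : (κ → ℝ) →L[ℝ] F) {v : NNReal} (hv : v ≠ 0) (hv1 : v ≤ 1) {r l : ℝ} {cA cB : κ → ℝ}
    (hA : P.map (fun ω => A (V ω)) = gaussianReal 0 v)
    (hB : P.map (fun ω => B (V ω)) = gaussianReal 0 v)
    (hcA : ∀ k, cov[fun ω => A (V ω), fun ω => V ω k; P] = cA k)
    (hcB : ∀ k, cov[fun ω => B (V ω), fun ω => V ω k; P] = cB k)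
    (hAA : A cA = v) (hBB : B cB = v) (hBA : B cA = r) (hAB : A cB = r)
    (hr : |r| ≤ v) (huA : ‖π cA‖ ≤ v) (huB : ‖π cB‖ ≤ v) (hl0 : 0 ≤ l) (hl : l ≤ 3 * v)
    {Φ : F → ℝ} (hΦ : CbSmooth Φ) {M : ℝ} (hM : DerivBound 6 M Φ) :
    |∫ ω, Φ (π (V ω)) * (A (V ω) ^ 3 - l * A (V ω)) * (B (V ω) ^ 3 - l * B (V ω)) ∂P| ≤
      100 * M * (v ^ 2 * |r| + v ^ 3 * ‖π cB‖) := by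
  have : IsProbabilityMeasure P := hV.isProbabilityMeasure
  have hM0 : 0 ≤ M := (abs_nonneg _).trans (hM.abs_le 0)
  have hint := fun (i j : ℕ) => integrable_mul_pow_mul_pow hV A B π hΦ i j
  have e : ∫ ω, Φ (π (V ω)) * (A (V ω) ^ 3 - l * A (V ω)) * (B (V ω) ^ 3 - l * B (V ω)) ∂P =
      mixedMoment P V A B π Φ 3 3 - l * mixedMoment P V A B π Φ 3 1
        - l * mixedMoment P V A B π Φ 1 3 + l ^ 2 * mixedMoment P V A B π Φ 1 1 := by
    unfold mixedMoment
    have h1 := integral_lin_comb (hint 3 3) (hint 3 1) (hint 1 3) (-l) (-l)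
    have h2 := integral_lin_comb (((hint 3 3).add ((hint 3 1).const_mul (-l))).add
      ((hint 1 3).const_mul (-l))) (hint 1 1) (hint 1 1) (l ^ 2) 0
    simp only [Pi.add_apply] at h2
    rw [h1] at h2
    calc _ = _ := by
          congr 1
          ext ω
          ring
      _ = _ := h2
      _ = _ := by ring
  have hrecA : ∀ Ψ : F → ℝ, CbSmooth Ψ → ∀ i j : ℕ, _ := fun Ψ hΨ i j =>
    mixedMoment_succ hV (B := B) π hv hA hcA hAA hBA hΨ i j
  have hrecB : ∀ Ψ : F → ℝ, CbSmooth Ψ → ∀ j : ℕ, mixedMoment P V A B π Ψ 0 (j + 1) =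
      mixedMoment P V A B π (dirDeriv (π cB) Ψ) 0 j +
        j * v * mixedMoment P V A B π Ψ 0 (j - 1) := fun Ψ hΨ j => by
    rw [mixedMoment_swap, mixedMoment_swap A B π _ 0, mixedMoment_swap A B π _ 0,
      mixedMoment_succ hV (B := A) π hv hB hcB hBB hAB hΨ j 0]
    simp
  rw [e, third_moment_expansion (S := CbSmooth) (fun Ψ h => h.dirDeriv _)
    (fun Ψ h => h.dirDeriv _) hrecA hrecB hΦ l]
  have bd : ∀ {Ψ : F → ℝ} {K : ℕ} {N : ℝ}, DerivBound K N Ψ → |mixedMoment P V A B π Ψ 0 0| ≤ N :=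
    fun h => abs_mixedMoment_zero_le A B π h
  have a1 := hM.dirDeriv (π cA)
  have a2 := a1.dirDeriv (π cA)
  have a3 := a2.dirDeriv (π cA)
  have b0 := bd hM
  have b1 := bd (a1.dirDeriv (π cB))
  have b2 := bd (a2.dirDeriv (π cB))
  have b3 := bd (a3.dirDeriv (π cB))
  have c1 := bd (((a1.dirDeriv (π cB)).dirDeriv (π cB)).dirDeriv (π cB))
  have c2 := bd ((a2.dirDeriv (π cB)).dirDeriv (π cB))
  have c3 := bd (((a3.dirDeriv (π cB)).dirDeriv (π cB)).dirDeriv (π cB))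
  have d1 := bd a2
  have d2 := bd ((hM.dirDeriv (π cB)).dirDeriv (π cB))
  have hv1' : (v : ℝ) ≤ 1 := by exact_mod_cast hv1
  exact abs_expansion_le hM0 v.2 hv1' hr (abs_le.2 ⟨by linarith [v.2], by linarith⟩)
    (norm_nonneg _) huA (norm_nonneg _) huB b0 c3 c2 b1 b3 d1 c1 d2

end MomentRecursion

section Processes

variable {Ω : Type*} [MeasurableSpace Ω] {P : Measure Ω} {X X1 X2 : ℝ → Ω → ℝ}

lemma IsCenteredGaussianProcess.exists_map_sum_eq {C : ℝ → ℝ → ℝ}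
    (hX : IsCenteredGaussianProcess P X C) {ι : Type*} [Fintype ι] (τ : ι → ℝ) (c : ι → ℝ) :
    ∃ v, P.map (fun ω => ∑ i, c i * X (τ i) ω) = gaussianReal 0 v := by
  have e := Fintype.equivFin ι
  have h := hX.2 _ (fun i => τ (e.symm i)) fun i => c (e.symm i)
  refine ⟨_, Eq.trans ?_ h⟩
  congr 1
  ext ω
  exact (e.symm.sum_comp fun i => c i * X (τ i) ω).symm

lemma measurable_sum_iSup_comap {Ω : Type*} (X : ℝ → Ω → ℝ) {ι : Type*} [Fintype ι] (τ c : ι → ℝ) :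
    Measurable[⨆ t : ℝ, MeasurableSpace.comap (X t) inferInstance]
      (fun ω => ∑ i, c i * X (τ i) ω) := by
  refine Finset.measurable_fun_sum _ fun i _ => Measurable.const_mul ?_ _
  exact (comap_measurable (X (τ i))).mono (le_iSup (fun t => MeasurableSpace.comap (X t) _) (τ i))
    le_rfl

lemma IndepProcesses.indepFun_sum (h : IndepProcesses P X1 X2) {ι ι' : Type*} [Fintype ι]
    [Fintype ι'] (τ c : ι → ℝ) (τ' c' : ι' → ℝ) :
    IndepFun (fun ω => ∑ i, c i * X1 (τ i) ω) (fun ω => ∑ i, c' i * X2 (τ' i) ω) P := by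
  exact indep_of_indep_of_le_left (indep_of_indep_of_le_right h (measurable_sum_iSup_comap X2 τ' c').comap_le)
    (measurable_sum_iSup_comap X1 τ c).comap_le

lemma IndepProcesses.indepFun (h : IndepProcesses P X1 X2) (s t : ℝ) :
    IndepFun (X1 s) (X2 t) P := by
  simpa using h.indepFun_sum (fun _ : Unit => s) (fun _ => 1) (fun _ : Unit => t) (fun _ => 1)

lemma IndepProcesses.symm (h : IndepProcesses P X1 X2) : IndepProcesses P X2 X1 :=
  ProbabilityTheory.Indep.symm h

/-- The vector of the values of two processes at finitely many times. -/
def sampleVector (X1 X2 : ℝ → Ω → ℝ) {ι : Type*} (τ : ι → ℝ) (ω : Ω) : ι ⊕ ι → ℝ :=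
  Sum.elim (fun i => X1 (τ i) ω) fun i => X2 (τ i) ω

lemma hasGaussianLaw_sampleVector [IsProbabilityMeasure P] {C : ℝ → ℝ → ℝ}
    (hX1 : IsCenteredGaussianProcess P X1 C) (hX2 : IsCenteredGaussianProcess P X2 C)
    (hInd : IndepProcesses P X1 X2) {ι : Type*} [Fintype ι] (τ : ι → ℝ) :
    HasGaussianLaw (sampleVector X1 X2 τ) P := by
  classical
  have hm : Measurable (sampleVector X1 X2 τ) := by
    refine measurable_pi_lambda _ ?_
    rintro (i | i)
    · exact hX1.1 _
    · exact hX2.1 _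
  have : IsProbabilityMeasure (P.map (sampleVector X1 X2 τ)) :=
    Measure.isProbabilityMeasure_map hm.aemeasurable
  refine ⟨isGaussian_of_map_eq_gaussianReal fun L => ?_⟩
  set c1 : ι → ℝ := fun i => L (Pi.single (Sum.inl i) 1)
  set c2 : ι → ℝ := fun i => L (Pi.single (Sum.inr i) 1)
  have hL : (⇑L ∘ sampleVector X1 X2 τ) =
      (fun ω => ∑ i, c1 i * X1 (τ i) ω) + fun ω => ∑ i, c2 i * X2 (τ i) ω := by
    ext ω
    have h := L.toLinearMap.pi_apply_eq_sum_univ (sampleVector X1 X2 τ ω)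
    rw [Fintype.sum_sum_type] at h
    refine Eq.trans h ?_
    simp only [sampleVector, Sum.elim_inl, Sum.elim_inr, smul_eq_mul, Pi.add_apply, c1, c2]
    have hs : ∀ k : ι ⊕ ι, (fun j => if k = j then (1 : ℝ) else 0) = Pi.single k 1 := fun k => by
      ext j
      simp [Pi.single_apply, eq_comm]
    congr 1 <;> refine Finset.sum_congr rfl fun i _ => ?_ <;> rw [mul_comm, hs] <;> rfl
  obtain ⟨v1, h1⟩ := hX1.exists_map_sum_eq τ c1
  obtain ⟨v2, h2⟩ := hX2.exists_map_sum_eq τ c2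
  refine ⟨0 + 0, v1 + v2, ?_⟩
  rw [Measure.map_map L.continuous.measurable hm, hL]
  exact gaussianReal_add_gaussianReal_of_indepFun (hInd.indepFun_sum τ c1 τ c2) h1 h2

lemma IsCenteredGaussianProcess.map_sub_eq (hX : IsCenteredGaussianProcess P X (covH (1 / 6)))
    (s t : ℝ) :
    P.map (fun ω => X s ω - X t ω) = gaussianReal 0 (Real.toNNReal (|s - t| ^ (1 / 3 : ℝ))) := by
  have h := hX.2 2 ![s, t] ![1, -1]
  simp [Fin.sum_univ_two, covH] at h
  rw [abs_sub_comm t s] at h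
  simp only [← sub_eq_add_neg] at h
  rw [h]
  congr 2
  norm_num
  ring

lemma IsCenteredGaussianProcess.map_eq (hX : IsCenteredGaussianProcess P X (covH (1 / 6)))
    (s : ℝ) : P.map (X s) = gaussianReal 0 (Real.toNNReal (|s| ^ (1 / 3 : ℝ))) := by
  have h := hX.2 1 ![s] ![1]
  simp [covH] at h
  refine h.trans ?_
  norm_num

lemma IsCenteredGaussianProcess.memLp (hX : IsCenteredGaussianProcess P X (covH (1 / 6)))
    (s : ℝ) : MemLp (X s) 2 P := by
  have h : MemLp id 2 (P.map (X s)) := by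
    rw [hX.map_eq s]
    exact memLp_id_gaussianReal' 2 (by simp)
  exact h.comp_of_map (hX.1 s).aemeasurable

lemma variance_of_map_eq_gaussianReal {Z : Ω → ℝ} (hZ : AEMeasurable Z P) {v : NNReal}
    (h : P.map Z = gaussianReal 0 v) : Var[Z; P] = v := by
  rw [← variance_fun_id_gaussianReal (μ := 0) (v := v), ← h,
    variance_map (by fun_prop) hZ]
  rfl

lemma IsCenteredGaussianProcess.covariance_eq [IsProbabilityMeasure P]
    (hX : IsCenteredGaussianProcess P X (covH (1 / 6))) (s t : ℝ) :
    cov[X s, X t; P] = covH (1 / 6) s t := by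
  have h1 := variance_of_map_eq_gaussianReal (hX.1 s).aemeasurable (hX.map_eq s)
  have h2 := variance_of_map_eq_gaussianReal (hX.1 t).aemeasurable (hX.map_eq t)
  have h3 := variance_of_map_eq_gaussianReal ((hX.1 s).sub (hX.1 t)).aemeasurable (hX.map_sub_eq s t)
  rw [variance_sub (hX.memLp s) (hX.memLp t), h1, h2, Real.coe_toNNReal _ (by positivity),
    Real.coe_toNNReal _ (by positivity), Real.coe_toNNReal _ (by positivity)] at h3
  have e : (2 * (1 / 6) : ℝ) = 1 / 3 := by norm_num
  rw [covH, e]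
  linarith

end Processes

section CovarianceSums

/-- The increment `(k + 1)^{1/3} - k^{1/3}`. -/
def cbrtIncr (k : ℕ) : ℝ := ((k : ℝ) + 1) ^ (1 / 3 : ℝ) - (k : ℝ) ^ (1 / 3 : ℝ)

lemma cbrtIncr_zero : cbrtIncr 0 = 1 := by simp [cbrtIncr]

lemma cbrtIncr_nonneg (k : ℕ) : 0 ≤ cbrtIncr k := by
  unfold cbrtIncr
  have : (k : ℝ) ^ (1 / 3 : ℝ) ≤ ((k : ℝ) + 1) ^ (1 / 3 : ℝ) := by gcongr; linarith
  linarith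

lemma cbrtIncr_succ_le (k : ℕ) : cbrtIncr (k + 1) ≤ cbrtIncr k := by
  have hc := Real.concaveOn_rpow (p := 1 / 3) (by norm_num) (by norm_num)
  have h := hc.2 (show (k : ℝ) ∈ Set.Ici 0 by simp)
    (show (k : ℝ) + 2 ∈ Set.Ici 0 from Set.mem_Ici.2 (by positivity))
    (show (0 : ℝ) ≤ 1 / 2 by norm_num) (show (0 : ℝ) ≤ 1 / 2 by norm_num) (by norm_num)
  have e : (1 / 2 : ℝ) • (k : ℝ) + (1 / 2 : ℝ) • ((k : ℝ) + 2) = k + 1 := by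
    simp only [smul_eq_mul]; ring
  rw [e] at h
  simp only [smul_eq_mul] at h
  have e2 : (k : ℝ) + 1 + 1 = k + 2 := by ring
  unfold cbrtIncr
  push_cast
  rw [e2]
  linarith

lemma cbrtIncr_le_one (k : ℕ) : cbrtIncr k ≤ 1 :=
  cbrtIncr_zero ▸ antitone_nat_of_succ_le cbrtIncr_succ_le (Nat.zero_le k)

lemma sum_cbrtIncr (N : ℕ) : ∑ k ∈ Finset.range N, cbrtIncr k = (N : ℝ) ^ (1 / 3 : ℝ) := by
  have := Finset.sum_range_sub (fun k : ℕ => (k : ℝ) ^ (1 / 3 : ℝ)) N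
  simpa [cbrtIncr] using this

lemma abs_sub_cbrt_of_le {i j : ℕ} (h : i ≤ j) :
    |(j : ℝ) + 1 - i| ^ (1 / 3 : ℝ) - |(j : ℝ) - i| ^ (1 / 3 : ℝ) = cbrtIncr (j - i) := by
  obtain ⟨k, rfl⟩ := Nat.exists_eq_add_of_le h
  have e1 : ((i + k : ℕ) : ℝ) + 1 - i = k + 1 := by push_cast; ring
  have e2 : ((i + k : ℕ) : ℝ) - i = k := by push_cast; ring
  rw [e1, e2, abs_of_nonneg (by positivity), abs_of_nonneg (by positivity), Nat.add_sub_cancel_left,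
    cbrtIncr]

lemma abs_sub_cbrt_of_lt {i j : ℕ} (h : j < i) :
    |(j : ℝ) + 1 - i| ^ (1 / 3 : ℝ) - |(j : ℝ) - i| ^ (1 / 3 : ℝ) = -cbrtIncr (i - 1 - j) := by
  obtain ⟨k, rfl⟩ := Nat.exists_eq_add_of_le (Nat.succ_le_of_lt h)
  have e1 : (j : ℝ) + 1 - (j.succ + k : ℕ) = -k := by push_cast; ring
  have e2 : (j : ℝ) - (j.succ + k : ℕ) = -(k + 1) := by push_cast; ring
  have e3 : j.succ + k - 1 - j = k := by omega
  rw [e1, e2, e3, abs_neg, abs_neg, abs_of_nonneg (by positivity), abs_of_nonneg (by positivity),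
    cbrtIncr]
  ring

lemma abs_abs_cbrt_sub_le_one (i j : ℕ) :
    |(|(j : ℝ) + 1 - i| ^ (1 / 3 : ℝ) - |(j : ℝ) - i| ^ (1 / 3 : ℝ))| ≤ 1 := by
  rcases le_or_gt i j with h | h
  · rw [abs_sub_cbrt_of_le h, abs_of_nonneg (cbrtIncr_nonneg _)]
    exact cbrtIncr_le_one _
  · rw [abs_sub_cbrt_of_lt h, abs_neg, abs_of_nonneg (cbrtIncr_nonneg _)]
    exact cbrtIncr_le_one _

lemma sum_abs_cbrt_sub_le {i N : ℕ} (hi : i ≤ N) :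
    ∑ j ∈ Finset.range N, |(|(j : ℝ) + 1 - i| ^ (1 / 3 : ℝ) - |(j : ℝ) - i| ^ (1 / 3 : ℝ))| ≤
      2 * (N : ℝ) ^ (1 / 3 : ℝ) := by
  obtain ⟨k, rfl⟩ := Nat.exists_eq_add_of_le hi
  rw [Finset.sum_range_add]
  have h1 : ∑ j ∈ Finset.range i,
      |(|(j : ℝ) + 1 - i| ^ (1 / 3 : ℝ) - |(j : ℝ) - i| ^ (1 / 3 : ℝ))| =
        (i : ℝ) ^ (1 / 3 : ℝ) := by
    rw [← sum_cbrtIncr, ← Finset.sum_range_reflect cbrtIncr]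
    refine Finset.sum_congr rfl fun j hj => ?_
    rw [abs_sub_cbrt_of_lt (Finset.mem_range.1 hj), abs_neg, abs_of_nonneg (cbrtIncr_nonneg _)]
  have h2 : ∑ j ∈ Finset.range k,
      |(|((i + j : ℕ) : ℝ) + 1 - i| ^ (1 / 3 : ℝ) - |((i + j : ℕ) : ℝ) - i| ^ (1 / 3 : ℝ))| =
        (k : ℝ) ^ (1 / 3 : ℝ) := by
    rw [← sum_cbrtIncr]
    refine Finset.sum_congr rfl fun j hj => ?_
    rw [abs_sub_cbrt_of_le (by omega), abs_of_nonneg (cbrtIncr_nonneg _), Nat.add_sub_cancel_left]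
  rw [h1, h2]
  have h3 : (i : ℝ) ^ (1 / 3 : ℝ) ≤ ((i + k : ℕ) : ℝ) ^ (1 / 3 : ℝ) := by gcongr
  have h4 : (k : ℝ) ^ (1 / 3 : ℝ) ≤ ((i + k : ℕ) : ℝ) ^ (1 / 3 : ℝ) := by gcongr; omega
  linarith

/-- Covariance of the `j`-th increment with the value of the process at the time `x`. -/
def incrCov (n j : ℕ) (x : ℝ) : ℝ :=
  covH (1 / 6) (dyadicPt n (j + 1)) x - covH (1 / 6) (dyadicPt n j) x

/-- The variance `2^{-n/6}` of an increment. -/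
def incrVar (n : ℕ) : ℝ := ((2 : ℝ) ^ (-(n : ℝ) / 2)) ^ (1 / 3 : ℝ)

lemma incrVar_pos (n : ℕ) : 0 < incrVar n := by unfold incrVar; positivity

lemma incrVar_le_one (n : ℕ) : incrVar n ≤ 1 := by
  unfold incrVar
  refine Real.rpow_le_one (by positivity) (Real.rpow_le_one_of_one_le_of_nonpos (by norm_num) ?_)
    (by norm_num)
  have : (0 : ℝ) ≤ n := by positivity
  linarith

lemma incrVar_sq (n : ℕ) : incrVar n ^ 2 = (2 : ℝ) ^ (-(n : ℝ) / 3) := by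
  unfold incrVar
  rw [← Real.rpow_mul (by norm_num), ← Real.rpow_natCast, ← Real.rpow_mul (by norm_num)]
  congr 1
  push_cast
  ring

lemma incrVar_cube (n : ℕ) : incrVar n ^ 3 = (2 : ℝ) ^ (-(n : ℝ) / 2) := by
  unfold incrVar
  rw [← Real.rpow_mul (by norm_num), ← Real.rpow_natCast, ← Real.rpow_mul (by norm_num)]
  congr 1
  push_cast
  ring

lemma abs_mul_dyadic_rpow (n : ℕ) (x : ℝ) :
    |x * (2 : ℝ) ^ (-(n : ℝ) / 2)| ^ (1 / 3 : ℝ) = |x| ^ (1 / 3 : ℝ) * incrVar n := by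
  rw [abs_mul, Real.mul_rpow (abs_nonneg _) (abs_nonneg _), incrVar,
    abs_of_pos (a := (2 : ℝ) ^ (-(n : ℝ) / 2)) (by positivity)]

lemma abs_dyadicPt_sub_rpow (n j : ℕ) :
    |dyadicPt n (j + 1) - dyadicPt n j| ^ (1 / 3 : ℝ) = incrVar n := by
  have e : dyadicPt n (j + 1) - dyadicPt n j = 1 * (2 : ℝ) ^ (-(n : ℝ) / 2) := by
    unfold dyadicPt; push_cast; ring
  rw [e, abs_mul_dyadic_rpow]
  simp

lemma covH_dyadicPt (n i j : ℕ) : covH (1 / 6) (dyadicPt n i) (dyadicPt n j) =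
    incrVar n / 2 * (|(i : ℝ)| ^ (1 / 3 : ℝ) + |(j : ℝ)| ^ (1 / 3 : ℝ)
      - |(i : ℝ) - j| ^ (1 / 3 : ℝ)) := by
  have e : (2 * (1 / 6) : ℝ) = 1 / 3 := by norm_num
  unfold covH dyadicPt
  rw [e, ← sub_mul, abs_mul_dyadic_rpow, abs_mul_dyadic_rpow, abs_mul_dyadic_rpow]
  ring

lemma incrCov_dyadicPt (n j i : ℕ) : incrCov n j (dyadicPt n i) =
    incrVar n / 2 * (cbrtIncr j
      - (|(j : ℝ) + 1 - i| ^ (1 / 3 : ℝ) - |(j : ℝ) - i| ^ (1 / 3 : ℝ))) := by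
  have h := abs_sub_cbrt_of_le (Nat.zero_le j)
  simp only [Nat.cast_zero, sub_zero, Nat.sub_zero] at h
  rw [← h, incrCov, covH_dyadicPt, covH_dyadicPt]
  push_cast
  ring

lemma abs_incrCov_le (n j i : ℕ) : |incrCov n j (dyadicPt n i)| ≤
    incrVar n / 2 * (cbrtIncr j
      + |(|(j : ℝ) + 1 - i| ^ (1 / 3 : ℝ) - |(j : ℝ) - i| ^ (1 / 3 : ℝ))|) := by
  have h0 := incrVar_pos n
  rw [incrCov_dyadicPt, abs_mul, abs_of_pos (by positivity : 0 < incrVar n / 2)]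
  gcongr
  refine (abs_sub _ _).trans ?_
  rw [abs_of_nonneg (cbrtIncr_nonneg j)]

lemma abs_incrCov_le_incrVar (n j i : ℕ) : |incrCov n j (dyadicPt n i)| ≤ incrVar n := by
  have h0 := incrVar_pos n
  have h1 := cbrtIncr_le_one j
  have h2 := abs_abs_cbrt_sub_le_one i j
  refine (abs_incrCov_le n j i).trans ?_
  nlinarith

/-- Covariance of the `j`-th increment with the `i`-th midpoint. -/
def midCov (n j i : ℕ) : ℝ :=
  (incrCov n j (dyadicPt n (i + 1)) + incrCov n j (dyadicPt n i)) / 2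

lemma abs_midCov_le (n j i : ℕ) : |midCov n j i| ≤ incrVar n := by
  have h1 := abs_incrCov_le_incrVar n j i
  have h2 := abs_incrCov_le_incrVar n j (i + 1)
  rw [abs_le] at *
  unfold midCov
  constructor <;> linarith

lemma sum_abs_incrCov_le (n : ℕ) {i N : ℕ} (hi : i ≤ N) :
    ∑ j ∈ Finset.range N, |incrCov n j (dyadicPt n i)| ≤
      3 / 2 * (incrVar n * (N : ℝ) ^ (1 / 3 : ℝ)) := by
  have h0 := incrVar_pos n
  refine (Finset.sum_le_sum fun j _ => abs_incrCov_le n j i).trans ?_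
  rw [← Finset.mul_sum, Finset.sum_add_distrib, sum_cbrtIncr]
  have := sum_abs_cbrt_sub_le hi
  nlinarith

lemma sum_abs_midCov_le (n : ℕ) {i N : ℕ} (hi : i < N) :
    ∑ j ∈ Finset.range N, |midCov n j i| ≤ 3 / 2 * (incrVar n * (N : ℝ) ^ (1 / 3 : ℝ)) := by
  have h1 := sum_abs_incrCov_le n hi.le
  have h2 := sum_abs_incrCov_le n (Nat.succ_le_of_lt hi)
  have h : ∀ j, |midCov n j i| ≤
      (|incrCov n j (dyadicPt n (i + 1))| + |incrCov n j (dyadicPt n i)|) / 2 := fun j => by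
    rw [midCov, abs_div, abs_two]
    gcongr
    exact abs_add_le _ _
  refine (Finset.sum_le_sum fun j _ => h j).trans ?_
  rw [← Finset.sum_div, Finset.sum_add_distrib]
  simp only [Nat.succ_eq_add_one] at h2
  linarith

lemma midCov_self (n j : ℕ) : midCov n j j = incrVar n / 2 * cbrtIncr j := by
  rw [midCov, incrCov_dyadicPt, incrCov_dyadicPt]
  have e1 : (j : ℝ) + 1 - (j + 1 : ℕ) = 0 := by push_cast; ring
  have e2 : (j : ℝ) - (j + 1 : ℕ) = -1 := by push_cast; ring
  have e3 : (j : ℝ) + 1 - j = 1 := by ring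
  rw [e1, e2, e3]
  simp
  ring

lemma sum_abs_midCov_self_le (n N : ℕ) : ∑ j ∈ Finset.range N, |midCov n j j| ≤
    1 / 2 * (incrVar n * (N : ℝ) ^ (1 / 3 : ℝ)) := by
  have h0 := incrVar_pos n
  refine le_of_eq ?_
  rw [← sum_cbrtIncr, Finset.mul_sum, Finset.mul_sum]
  refine Finset.sum_congr rfl fun j _ => ?_
  rw [midCov_self, abs_mul, abs_of_nonneg (cbrtIncr_nonneg j),
    abs_of_pos (by positivity : 0 < incrVar n / 2)]
  ring

/-- Covariance of the `i`-th and `j`-th increments. -/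
def incrIncrCov (n i j : ℕ) : ℝ :=
  incrCov n i (dyadicPt n (j + 1)) - incrCov n i (dyadicPt n j)

lemma incrIncrCov_eq (n i j : ℕ) : incrIncrCov n i j = incrVar n / 2 *
    ((|(i : ℝ) + 1 - j| ^ (1 / 3 : ℝ) - |(i : ℝ) - j| ^ (1 / 3 : ℝ))
      - (|(i : ℝ) - j| ^ (1 / 3 : ℝ) - |(i : ℝ) - j - 1| ^ (1 / 3 : ℝ))) := by
  rw [incrIncrCov, incrCov_dyadicPt, incrCov_dyadicPt]
  have e1 : (i : ℝ) + 1 - (j + 1 : ℕ) = i - j := by push_cast; ring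
  have e2 : (i : ℝ) - (j + 1 : ℕ) = i - j - 1 := by push_cast; ring
  rw [e1, e2]
  ring

lemma incrIncrCov_comm (n i j : ℕ) : incrIncrCov n i j = incrIncrCov n j i := by
  have e1 : |(i : ℝ) + 1 - j| = |(j : ℝ) - i - 1| := by rw [← abs_neg]; congr 1; ring
  have e2 : |(i : ℝ) - j - 1| = |(j : ℝ) + 1 - i| := by rw [← abs_neg]; congr 1; ring
  rw [incrIncrCov_eq, incrIncrCov_eq, e1, e2, abs_sub_comm (i : ℝ) j]
  ring

lemma incrIncrCov_self (n i : ℕ) : incrIncrCov n i i = incrVar n := by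
  rw [incrIncrCov_eq]
  have e1 : (i : ℝ) + 1 - i = 1 := by ring
  rw [e1]
  simp
  ring

lemma abs_incrIncrCov_of_lt (n i k : ℕ) :
    |incrIncrCov n (i + (k + 1)) i| = incrVar n / 2 * (cbrtIncr k - cbrtIncr (k + 1)) := by
  have h0 := incrVar_pos n
  have h1 := cbrtIncr_succ_le k
  have e := abs_sub_cbrt_of_le (show i ≤ i + (k + 1) by omega)
  have e' := abs_sub_cbrt_of_le (show i + 1 ≤ i + (k + 1) by omega)
  have e1 : ((i + (k + 1) : ℕ) : ℝ) + 1 - (i + 1 : ℕ) = (i + (k + 1) : ℕ) - i := by push_cast; ring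
  have e2 : ((i + (k + 1) : ℕ) : ℝ) - (i + 1 : ℕ) = (i + (k + 1) : ℕ) - i - 1 := by push_cast; ring
  have e3 : i + (k + 1) - (i + 1) = k := by omega
  rw [e1, e2, e3] at e'
  rw [incrIncrCov_eq, e, e', Nat.add_sub_cancel_left, abs_mul,
    abs_of_pos (by positivity : 0 < incrVar n / 2), abs_sub_comm, abs_of_nonneg (by linarith)]

lemma abs_incrIncrCov_le (n i j : ℕ) : |incrIncrCov n i j| ≤ incrVar n := by
  have h0 := incrVar_pos n
  wlog h : j ≤ i generalizing i j
  · rw [incrIncrCov_comm]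
    exact this j i (by omega)
  rcases h.eq_or_lt with rfl | h
  · rw [incrIncrCov_self, abs_of_pos h0]
  · obtain ⟨k, rfl⟩ := Nat.exists_eq_add_of_le (Nat.succ_le_of_lt h)
    have e : j.succ + k = j + (k + 1) := by omega
    have := cbrtIncr_le_one k
    have := cbrtIncr_nonneg (k + 1)
    rw [e, abs_incrIncrCov_of_lt]
    nlinarith

lemma sum_cbrtIncr_sub_le (N : ℕ) :
    ∑ k ∈ Finset.range N, (cbrtIncr k - cbrtIncr (k + 1)) ≤ 1 := by
  rw [Finset.sum_range_sub', cbrtIncr_zero]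
  linarith [cbrtIncr_nonneg N]

lemma sum_abs_incrIncrCov_le (n : ℕ) {i N : ℕ} (hi : i < N) :
    ∑ j ∈ Finset.range N, |incrIncrCov n i j| ≤ 2 * incrVar n := by
  have h0 := incrVar_pos n
  obtain ⟨k, rfl⟩ := Nat.exists_eq_add_of_le (Nat.succ_le_of_lt hi)
  have e : i.succ + k = i + (k + 1) := by omega
  rw [e, Finset.sum_range_add, Finset.sum_range_succ']
  have h1 : ∑ j ∈ Finset.range i, |incrIncrCov n i j| ≤ incrVar n / 2 := by
    rw [← Finset.sum_range_reflect]
    have : ∀ j ∈ Finset.range i, |incrIncrCov n i (i - 1 - j)| =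
        incrVar n / 2 * (cbrtIncr j - cbrtIncr (j + 1)) := fun j hj => by
      have hj := Finset.mem_range.1 hj
      rw [← abs_incrIncrCov_of_lt n (i - 1 - j) j]
      congr 2
      omega
    rw [Finset.sum_congr rfl this, ← Finset.mul_sum]
    nlinarith [sum_cbrtIncr_sub_le i]
  have h2 : ∑ j ∈ Finset.range k, |incrIncrCov n i (i + (j + 1))| ≤ incrVar n / 2 := by
    simp only [incrIncrCov_comm n i, abs_incrIncrCov_of_lt]
    rw [← Finset.mul_sum]
    nlinarith [sum_cbrtIncr_sub_le k]
  rw [add_zero, incrIncrCov_self, abs_of_pos h0]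
  linarith

end CovarianceSums

section Assembly

variable {Ω : Type*} [MeasurableSpace Ω] {P : Measure Ω} {X1 X2 : ℝ → Ω → ℝ}

/-- The product of four functions evaluated at four points of the plane. -/
def prodFour (f1 f2 f3 f4 : ℝ → ℝ → ℝ) (w : Fin 4 → ℝ × ℝ) : ℝ :=
  f1 (w 0).1 (w 0).2 * f2 (w 1).1 (w 1).2 * f3 (w 2).1 (w 2).2 * f4 (w 3).1 (w 3).2

lemma cbSmooth_prodFour {f1 f2 f3 f4 : ℝ → ℝ → ℝ} (hf1 : CbSmooth2 f1) (hf2 : CbSmooth2 f2)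
    (hf3 : CbSmooth2 f3) (hf4 : CbSmooth2 f4) : CbSmooth (prodFour f1 f2 f3 f4) :=
  (((hf1.comp_clm (ContinuousLinearMap.proj (R := ℝ) (φ := fun _ : Fin 4 => ℝ × ℝ) 0)).mul
    (hf2.comp_clm (ContinuousLinearMap.proj (R := ℝ) (φ := fun _ : Fin 4 => ℝ × ℝ) 1))).mul
    (hf3.comp_clm (ContinuousLinearMap.proj (R := ℝ) (φ := fun _ : Fin 4 => ℝ × ℝ) 2))).mul
    (hf4.comp_clm (ContinuousLinearMap.proj (R := ℝ) (φ := fun _ : Fin 4 => ℝ × ℝ) 3))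

lemma CbSmooth2.swap {f : ℝ → ℝ → ℝ} (hf : CbSmooth2 f) : CbSmooth2 fun x y => f y x :=
  hf.comp_clm ((ContinuousLinearMap.snd ℝ ℝ ℝ).prod (ContinuousLinearMap.fst ℝ ℝ ℝ))

lemma Xmid_swap {Ω : Type*} (X1 X2 : ℝ → Ω → ℝ) (f : ℝ → ℝ → ℝ) (n j : ℕ) (ω : Ω) :
    Xmid X2 X1 (fun x y => f y x) n j ω = Xmid X1 X2 f n j ω := rfl

/-- The end points of four dyadic intervals. -/
def endTime (n : ℕ) (idx : Fin 4 → ℕ) (k : Fin 4 × Fin 2) : ℝ := dyadicPt n (idx k.1 + k.2)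

/-- Evaluation of a sample vector at one index. -/
def coordCLM (k : (Fin 4 × Fin 2) ⊕ (Fin 4 × Fin 2)) :
    ((Fin 4 × Fin 2) ⊕ (Fin 4 × Fin 2) → ℝ) →L[ℝ] ℝ :=
  ContinuousLinearMap.proj (R := ℝ) (φ := fun _ => ℝ) k

lemma coordCLM_apply (k : (Fin 4 × Fin 2) ⊕ (Fin 4 × Fin 2))
    (x : (Fin 4 × Fin 2) ⊕ (Fin 4 × Fin 2) → ℝ) : coordCLM k x = x k := rfl

/-- The increment of the first process over the `a`-th interval. -/
def incrCLM (a : Fin 4) : ((Fin 4 × Fin 2) ⊕ (Fin 4 × Fin 2) → ℝ) →L[ℝ] ℝ :=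
  coordCLM (Sum.inl (a, 1)) - coordCLM (Sum.inl (a, 0))

/-- The midpoints of both processes over all four intervals. -/
def midCLM : ((Fin 4 × Fin 2) ⊕ (Fin 4 × Fin 2) → ℝ) →L[ℝ] (Fin 4 → ℝ × ℝ) :=
  ContinuousLinearMap.pi fun a =>
    ((1 / 2 : ℝ) • (coordCLM (Sum.inl (a, 1)) +
      coordCLM (Sum.inl (a, 0)))).prod
    ((1 / 2 : ℝ) • (coordCLM (Sum.inr (a, 1)) +
      coordCLM (Sum.inr (a, 0))))

/-- The covariances of the `j`-th increment of the first process with the sample vector. -/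
def incrCovVector (n : ℕ) (idx : Fin 4 → ℕ) (j : ℕ) : (Fin 4 × Fin 2) ⊕ (Fin 4 × Fin 2) → ℝ :=
  Sum.elim (fun k => incrCov n j (endTime n idx k)) fun _ => 0

lemma incrCLM_sampleVector {Ω : Type*} {X1 X2 : ℝ → Ω → ℝ} (n : ℕ)
    (idx : Fin 4 → ℕ) (a : Fin 4) (ω : Ω) :
    incrCLM a (sampleVector X1 X2 (endTime n idx) ω) = Xincr X1 n (idx a) ω := by
  simp [incrCLM, coordCLM_apply, sampleVector, endTime, Xincr]

lemma midCLM_sampleVector {Ω : Type*} {X1 X2 : ℝ → Ω → ℝ} (n : ℕ)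
    (idx : Fin 4 → ℕ) (a : Fin 4) (ω : Ω) :
    midCLM (sampleVector X1 X2 (endTime n idx) ω) a =
      ((X1 (dyadicPt n (idx a + 1)) ω + X1 (dyadicPt n (idx a)) ω) / 2,
        (X2 (dyadicPt n (idx a + 1)) ω + X2 (dyadicPt n (idx a)) ω) / 2) := by
  ext <;> simp [midCLM, coordCLM_apply, sampleVector, endTime] <;> ring

lemma incrCLM_incrCovVector (n : ℕ) (idx : Fin 4 → ℕ) (a : Fin 4) (j : ℕ) :
    incrCLM a (incrCovVector n idx j) = incrIncrCov n j (idx a) := by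
  simp [incrCLM, coordCLM_apply, incrCovVector, endTime, incrIncrCov]

lemma midCLM_incrCovVector (n : ℕ) (idx : Fin 4 → ℕ) (a : Fin 4) (j : ℕ) :
    midCLM (incrCovVector n idx j) a = (midCov n j (idx a), 0) := by
  ext <;> simp [midCLM, coordCLM_apply, incrCovVector, endTime, midCov] ; ring

lemma norm_midCLM_incrCovVector_le (n : ℕ) (idx : Fin 4 → ℕ) (j : ℕ) :
    ‖midCLM (incrCovVector n idx j)‖ ≤ incrVar n := by
  refine (pi_norm_le_iff_of_nonneg (incrVar_pos n).le).2 fun a => ?_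
  rw [midCLM_incrCovVector]
  simp [Prod.norm_def, abs_midCov_le]

lemma norm_midCLM_incrCovVector_le_sum (n : ℕ) (idx : Fin 4 → ℕ) (j : ℕ) :
    ‖midCLM (incrCovVector n idx j)‖ ≤ ∑ a, |midCov n j (idx a)| := by
  have h0 : ∀ a ∈ Finset.univ, 0 ≤ |midCov n j (idx a)| := fun a _ => abs_nonneg _
  refine (pi_norm_le_iff_of_nonneg (Finset.sum_nonneg h0)).2 fun a => ?_
  rw [midCLM_incrCovVector]
  simpa [Prod.norm_def] using Finset.single_le_sum h0 (Finset.mem_univ a)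

lemma cov_incr_sampleVector [IsProbabilityMeasure P]
    (hX1 : IsCenteredGaussianProcess P X1 (covH (1 / 6)))
    (hX2 : IsCenteredGaussianProcess P X2 (covH (1 / 6))) (hInd : IndepProcesses P X1 X2)
    (n : ℕ) (idx : Fin 4 → ℕ) (j : ℕ) (k : (Fin 4 × Fin 2) ⊕ (Fin 4 × Fin 2)) :
    cov[fun ω => Xincr X1 n j ω, fun ω => sampleVector X1 X2 (endTime n idx) ω k; P] =
      incrCovVector n idx j k := by
  unfold Xincr
  rcases k with k | k
  · simp only [sampleVector, incrCovVector, Sum.elim_inl]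
    rw [covariance_fun_sub_left (hX1.memLp _) (hX1.memLp _) (hX1.memLp _), hX1.covariance_eq,
      hX1.covariance_eq, incrCov]
  · simp only [sampleVector, incrCovVector, Sum.elim_inr]
    rw [covariance_fun_sub_left (hX1.memLp _) (hX1.memLp _) (hX2.memLp _),
      (hInd.indepFun _ _).covariance_eq_zero (hX1.memLp _) (hX2.memLp _),
      (hInd.indepFun _ _).covariance_eq_zero (hX1.memLp _) (hX2.memLp _), sub_zero]

/-- Bound of a single summand. -/
lemma abs_integral_prodFour_le [IsProbabilityMeasure P]
    (hX1 : IsCenteredGaussianProcess P X1 (covH (1 / 6)))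
    (hX2 : IsCenteredGaussianProcess P X2 (covH (1 / 6))) (hInd : IndepProcesses P X1 X2)
    {f1 f2 f3 f4 : ℝ → ℝ → ℝ} (hΦ : CbSmooth (prodFour f1 f2 f3 f4)) {M : ℝ}
    (hM : DerivBound 6 M (prodFour f1 f2 f3 f4)) (n i1 i2 i3 i4 : ℕ) :
    |∫ ω, (Xmid X1 X2 f1 n i1 ω * Xmid X1 X2 f2 n i2 ω *
      Xmid X1 X2 f3 n i3 ω * Xmid X1 X2 f4 n i4 ω *
      (Xincr X1 n i3 ω ^ 3 - 3 * (2 : ℝ) ^ (-(n : ℝ) / 3) * Xincr X1 n i3 ω) *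
      (Xincr X1 n i4 ω ^ 3 - 3 * (2 : ℝ) ^ (-(n : ℝ) / 3) * Xincr X1 n i4 ω)) ∂P| ≤
    100 * M * (incrVar n ^ 2 * |incrIncrCov n i3 i4| + incrVar n ^ 3 *
      (|midCov n i4 i1| + |midCov n i4 i2| + |midCov n i4 i3| + |midCov n i4 i4|)) := by
  set idx : Fin 4 → ℕ := ![i1, i2, i3, i4] with hidx
  have h0 := incrVar_pos n
  have h1 := incrVar_le_one n
  have hM0 : 0 ≤ M := (abs_nonneg _).trans (hM.abs_le 0)
  have hv : ((incrVar n).toNNReal : ℝ) = incrVar n := Real.coe_toNNReal _ h0.le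
  have hlaw : ∀ a, P.map (fun ω => incrCLM a (sampleVector X1 X2 (endTime n idx) ω)) =
      gaussianReal 0 (incrVar n).toNNReal := fun a => by
    simp only [incrCLM_sampleVector]
    rw [← abs_dyadicPt_sub_rpow n (idx a)]
    exact hX1.map_sub_eq _ _
  have hcov : ∀ a k, cov[fun ω => incrCLM a (sampleVector X1 X2 (endTime n idx) ω),
      fun ω => sampleVector X1 X2 (endTime n idx) ω k; P] = incrCovVector n idx (idx a) k :=
    fun a k => by
      simp only [incrCLM_sampleVector]
      exact cov_incr_sampleVector hX1 hX2 hInd n idx _ k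
  have key := abs_integral_mul_cubic_mul_cubic_le
    (hasGaussianLaw_sampleVector hX1 hX2 hInd (endTime n idx)) (A := incrCLM 2) (B := incrCLM 3)
    midCLM (v := (incrVar n).toNNReal) (by simpa using h0) (by simpa using h1)
    (r := incrIncrCov n i3 i4) (l := 3 * (2 : ℝ) ^ (-(n : ℝ) / 3)) (hlaw 2) (hlaw 3) (hcov 2)
    (hcov 3) (by rw [incrCLM_incrCovVector, incrIncrCov_self, hv])
    (by rw [incrCLM_incrCovVector, incrIncrCov_self, hv])
    (by rw [incrCLM_incrCovVector]; rfl)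
    (by rw [incrCLM_incrCovVector, incrIncrCov_comm]; rfl)
    (by rw [hv]; exact abs_incrIncrCov_le _ _ _)
    (by rw [hv]; exact norm_midCLM_incrCovVector_le _ _ _)
    (by rw [hv]; exact norm_midCLM_incrCovVector_le _ _ _) (by positivity)
    (by rw [hv, ← incrVar_sq]; nlinarith) hΦ hM
  simp only [incrCLM_sampleVector, prodFour, midCLM_sampleVector] at key
  refine key.trans ?_
  rw [hv]
  gcongr
  refine (norm_midCLM_incrCovVector_le_sum n idx _).trans_eq ?_
  simp [Fin.sum_univ_four, hidx]

lemma sum_bound_le (n : ℕ) {N i1 i2 : ℕ} (h1 : i1 < N) (h2 : i2 < N) {t : ℝ} (ht : 0 ≤ t)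
    (hN : (N : ℝ) * (2 : ℝ) ^ (-(n : ℝ) / 2) ≤ t) :
    ∑ i3 ∈ Finset.range N, ∑ i4 ∈ Finset.range N,
      (incrVar n ^ 2 * |incrIncrCov n i3 i4| + incrVar n ^ 3 *
        (|midCov n i4 i1| + |midCov n i4 i2| + |midCov n i4 i3| + |midCov n i4 i4|)) ≤
      7 * (t + t ^ 2) := by
  have h0 := incrVar_pos n
  have hT : incrVar n * (N : ℝ) ^ (1 / 3 : ℝ) ≤ 1 + t := by
    calc incrVar n * (N : ℝ) ^ (1 / 3 : ℝ) =
        ((N : ℝ) * (2 : ℝ) ^ (-(n : ℝ) / 2)) ^ (1 / 3 : ℝ) := by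
          rw [Real.mul_rpow (by positivity) (by positivity), incrVar, mul_comm]
      _ ≤ (1 + t) ^ (1 / 3 : ℝ) := by gcongr; linarith
      _ ≤ (1 + t) ^ (1 : ℝ) := Real.rpow_le_rpow_of_exponent_le (by linarith) (by norm_num)
      _ = 1 + t := Real.rpow_one _
  have hrow : ∀ i3 ∈ Finset.range N, ∑ i4 ∈ Finset.range N,
      (incrVar n ^ 2 * |incrIncrCov n i3 i4| + incrVar n ^ 3 *
        (|midCov n i4 i1| + |midCov n i4 i2| + |midCov n i4 i3| + |midCov n i4 i4|)) ≤
      incrVar n ^ 3 * (2 + 5 * (1 + t)) := fun i3 h3 => by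
    rw [Finset.sum_add_distrib, ← Finset.mul_sum, ← Finset.mul_sum, Finset.sum_add_distrib,
      Finset.sum_add_distrib, Finset.sum_add_distrib]
    have e1 := sum_abs_midCov_le n h1
    have e2 := sum_abs_midCov_le n h2
    have e3 := sum_abs_midCov_le n (Finset.mem_range.1 h3)
    have e4 := sum_abs_midCov_self_le n N
    calc _ ≤ incrVar n ^ 2 * (2 * incrVar n) + incrVar n ^ 3 * (5 * (1 + t)) := by
          gcongr
          · exact sum_abs_incrIncrCov_le n (Finset.mem_range.1 h3)
          · linarith
      _ = _ := by ring
  refine (Finset.sum_le_sum hrow).trans ?_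
  rw [Finset.sum_const, Finset.card_range, nsmul_eq_mul, ← mul_assoc, incrVar_cube]
  calc _ ≤ t * (2 + 5 * (1 + t)) := by gcongr
    _ ≤ _ := by nlinarith [sq_nonneg t]

lemma nSteps_mul_le (n : ℕ) {t : ℝ} (ht : 0 ≤ t) :
    (nSteps n t : ℝ) * (2 : ℝ) ^ (-(n : ℝ) / 2) ≤ t := by
  have h : (nSteps n t : ℝ) ≤ (2 : ℝ) ^ ((n : ℝ) / 2) * t := Nat.floor_le (by positivity)
  calc _ ≤ (2 : ℝ) ^ ((n : ℝ) / 2) * t * (2 : ℝ) ^ (-(n : ℝ) / 2) := by gcongr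
    _ = ((2 : ℝ) ^ ((n : ℝ) / 2) * (2 : ℝ) ^ (-(n : ℝ) / 2)) * t := by ring
    _ = t := by
      rw [← Real.rpow_add (by norm_num), neg_div, add_neg_cancel, Real.rpow_zero, one_mul]

lemma exists_sum_bound [IsProbabilityMeasure P]
    (hX1 : IsCenteredGaussianProcess P X1 (covH (1 / 6)))
    (hX2 : IsCenteredGaussianProcess P X2 (covH (1 / 6))) (hInd : IndepProcesses P X1 X2)
    {f1 f2 f3 f4 : ℝ → ℝ → ℝ} (hf1 : CbSmooth2 f1) (hf2 : CbSmooth2 f2) (hf3 : CbSmooth2 f3)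
    (hf4 : CbSmooth2 f4) :
    ∃ C : ℝ, 0 < C ∧ ∀ t : ℝ, 0 ≤ t → ∀ n : ℕ, 1 ≤ n →
      ∀ i1 ∈ Finset.range (nSteps n t), ∀ i2 ∈ Finset.range (nSteps n t),
        (∑ i3 ∈ Finset.range (nSteps n t), ∑ i4 ∈ Finset.range (nSteps n t),
          abs (∫ ω,
            (Xmid X1 X2 f1 n i1 ω * Xmid X1 X2 f2 n i2 ω *
              Xmid X1 X2 f3 n i3 ω * Xmid X1 X2 f4 n i4 ω *
              (Xincr X1 n i3 ω ^ 3 - 3 * (2 : ℝ) ^ (-(n : ℝ) / 3) * Xincr X1 n i3 ω) *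
              (Xincr X1 n i4 ω ^ 3 - 3 * (2 : ℝ) ^ (-(n : ℝ) / 3) * Xincr X1 n i4 ω)) ∂P)) ≤
        C * (t + t ^ 2) := by
  have hΦ := cbSmooth_prodFour hf1 hf2 hf3 hf4
  obtain ⟨M, hM0, hM⟩ := hΦ.exists_derivBound 6
  refine ⟨700 * M + 1, by positivity, fun t ht n _ i1 h1 i2 h2 => ?_⟩
  refine (Finset.sum_le_sum fun i3 _ => Finset.sum_le_sum fun i4 _ =>
    abs_integral_prodFour_le hX1 hX2 hInd hΦ hM n i1 i2 i3 i4).trans ?_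
  simp only [← Finset.mul_sum]
  calc _ ≤ 100 * M * (7 * (t + t ^ 2)) := by
        gcongr
        exact sum_bound_le n (Finset.mem_range.1 h1) (Finset.mem_range.1 h2) ht (nSteps_mul_le n ht)
    _ ≤ _ := by nlinarith [sq_nonneg t]

end Assembly

theorem third_chaos_moment_bound_two_free_indices
    {Ω : Type*} [MeasurableSpace Ω] (P : Measure Ω) [IsProbabilityMeasure P]
    (X1 X2 : ℝ → Ω → ℝ)
    (hX1 : IsCenteredGaussianProcess P X1 (covH (1 / 6)))
    (hX2 : IsCenteredGaussianProcess P X2 (covH (1 / 6)))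
    (hInd : IndepProcesses P X1 X2)
    (f1 f2 f3 f4 : ℝ → ℝ → ℝ)
    (hf1 : CbSmooth2 f1) (hf2 : CbSmooth2 f2) (hf3 : CbSmooth2 f3) (hf4 : CbSmooth2 f4) :
    ∀ Y : ℝ → Ω → ℝ, Y = X1 ∨ Y = X2 →
      ∃ C : ℝ, 0 < C ∧ ∀ t : ℝ, 0 ≤ t → ∀ n : ℕ, 1 ≤ n →
        ∀ i1 ∈ Finset.range (nSteps n t), ∀ i2 ∈ Finset.range (nSteps n t),
          (∑ i3 ∈ Finset.range (nSteps n t), ∑ i4 ∈ Finset.range (nSteps n t),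
            abs (∫ ω,
              (Xmid X1 X2 f1 n i1 ω * Xmid X1 X2 f2 n i2 ω *
                Xmid X1 X2 f3 n i3 ω * Xmid X1 X2 f4 n i4 ω *
                (Xincr Y n i3 ω ^ 3 - 3 * (2 : ℝ) ^ (-(n : ℝ) / 3) * Xincr Y n i3 ω) *
                (Xincr Y n i4 ω ^ 3 - 3 * (2 : ℝ) ^ (-(n : ℝ) / 3) * Xincr Y n i4 ω)) ∂P)) ≤
          C * (t + t ^ 2) := by
  rintro Y (rfl | rfl)
  · exact exists_sum_bound hX1 hX2 hInd hf1 hf2 hf3 hf4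
  · have h := exists_sum_bound hX2 hX1 hInd.symm hf1.swap hf2.swap hf3.swap hf4.swap
    simp only [Xmid_swap] at h
    exact h

end
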